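/- Let P be a submonoid of a group G and let p₁, q₁, …, p_n, q_n ∈ P with p₁⁻¹q₁ ⋯ p_n⁻¹q_n ≠ e in G. Then for the operator W = V_{p₁}* V_{q₁} ⋯ V_{p_n}* V_{q_n} on ℓ²(P), all diagonal matrix entries vanish: ⟨W δ_s, δ_s⟩ = 0 for every s ∈ P. -/

import Mathlib

noncomputable section

open ContinuousLinearMap
open scoped Classical

variable {G : Type*} [Group G]

/-- The Hilbert space ℓ²(P). -/
abbrev l2 (P : Submonoid G) : Type _ := lp (fun _ : P => ℂ) 2

/-- The standard orthonormal basis vector δ_s of ℓ²(P). -/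
def delta (P : Submonoid G) (s : P) : l2 P :=
  letI := Classical.decEq P
  lp.single 2 s 1

/-- The set pX = {px : x ∈ X}. -/
def lmul (P : Submonoid G) (p : P) (X : Set P) : Set P := (fun x => p * x) '' X

/-- The set p⁻¹X = {y ∈ P : py ∈ X}. -/
def linv (P : Submonoid G) (p : P) (X : Set P) : Set P := {y : P | p * y ∈ X}

/-- The set p₁⁻¹q₁ ⋯ pₙ⁻¹qₙ X, the operations being applied iteratively from the right;
the word is encoded as the list [(p₁,q₁),…,(pₙ,qₙ)]. -/
def wordSet (P : Submonoid G) (l : List (P × P)) (X : Set P) : Set P :=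
  l.foldr (fun a Y => linv P a.1 (lmul P a.2 Y)) X

/-- The operator V_{p₁}* V_{q₁} ⋯ V_{pₙ}* V_{qₙ} on ℓ²(P), the word being encoded as the
list [(p₁,q₁),…,(pₙ,qₙ)]. -/
def opWord (P : Submonoid G) (V : P → (l2 P →L[ℂ] l2 P)) (l : List (P × P)) :
    l2 P →L[ℂ] l2 P :=
  (l.map fun a => (ContinuousLinearMap.adjoint (V a.1)) * (V a.2)).prod

/-- The group element p₁⁻¹q₁ ⋯ pₙ⁻¹qₙ of G. -/
def grpWord (P : Submonoid G) (l : List (P × P)) : G :=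
  (l.map fun a => ((a.1 : G))⁻¹ * (a.2 : G)).prod


open scoped ComplexInnerProductSpace

theorem inner_delta_left (P : Submonoid G) (s : P) (f : l2 P) :
    ⟪delta P s, f⟫ = f s := by
  simp [delta, lp.inner_single_left]

theorem delta_apply (P : Submonoid G) (s t : P) :
    (delta P s : P → ℂ) t = if t = s then 1 else 0 := by
  by_cases h : t = s
  · subst h
    simp [delta]
  · simp [delta, h]

theorem adjoint_apply_delta (P : Submonoid G) (V : P → (l2 P →L[ℂ] l2 P))
    (hV : ∀ p s : P, V p (delta P s) = delta P (p * s)) (p u t : P) :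
    (adjoint (V p) (delta P u) : P → ℂ) t = if p * t = u then 1 else 0 := by
  rw [← inner_delta_left, adjoint_inner_right, hV, inner_delta_left, delta_apply]

theorem adjoint_delta_eq_zero_or (P : Submonoid G) (V : P → (l2 P →L[ℂ] l2 P))
    (hV : ∀ p s : P, V p (delta P s) = delta P (p * s)) (p u : P) :
    adjoint (V p) (delta P u) = 0 ∨
      ∃ t : P, (t : G) = (p : G)⁻¹ * u ∧ adjoint (V p) (delta P u) = delta P t := by
  by_cases h : ∃ t : P, p * t = u
  · obtain ⟨t, rfl⟩ := h
    refine Or.inr ⟨t, by simp, ?_⟩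
    ext x
    rw [adjoint_apply_delta P V hV, delta_apply]
    simp
  · left
    ext x
    rw [adjoint_apply_delta P V hV, if_neg fun hx => h ⟨x, hx⟩]
    rfl

theorem opWord_delta_eq_zero_or (P : Submonoid G) (V : P → (l2 P →L[ℂ] l2 P))
    (hV : ∀ p s : P, V p (delta P s) = delta P (p * s)) (l : List (P × P)) (s : P) :
    opWord P V l (delta P s) = 0 ∨
      ∃ t : P, (t : G) = grpWord P l * s ∧ opWord P V l (delta P s) = delta P t := by
  induction l with
  | nil => exact Or.inr ⟨s, by simp [grpWord], by simp [opWord]⟩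
  | cons a l ih =>
    have hcons : opWord P V (a :: l) (delta P s) =
        adjoint (V a.1) (V a.2 (opWord P V l (delta P s))) := by
      simp [opWord]
    rw [hcons]
    rcases ih with h | ⟨t, ht, h⟩
    · simp [h]
    · rw [h, hV]
      refine (adjoint_delta_eq_zero_or P V hV a.1 (a.2 * t)).imp_right ?_
      rintro ⟨r, hr, h'⟩
      refine ⟨r, ?_, h'⟩
      simp [hr, ht, grpWord, mul_assoc]

/-- If p₁⁻¹q₁ ⋯ pₙ⁻¹qₙ ≠ e in G, then all diagonal matrix entries of
W = V_{p₁}* V_{q₁} ⋯ V_{pₙ}* V_{qₙ} vanish: ⟨W δ_s, δ_s⟩ = 0 for every s ∈ P. -/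
theorem stmt10 (P : Submonoid G)
    (V : P → (l2 P →L[ℂ] l2 P))
    (hV : ∀ p s : P, V p (delta P s) = delta P (p * s))
    (n : ℕ) (p q : Fin n → P)
    (hg : grpWord P (List.ofFn fun i => (p i, q i)) ≠ 1) (s : P) :
    ⟪opWord P V (List.ofFn fun i => (p i, q i)) (delta P s), delta P s⟫ = 0 := by
  rcases opWord_delta_eq_zero_or P V hV (List.ofFn fun i => (p i, q i)) s with h | ⟨t, ht, h⟩
  · rw [h, inner_zero_left]
  · rw [h, inner_delta_left, delta_apply, if_neg]
    rintro rfl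
    exact hg (mul_eq_right.mp ht.symm)
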